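/- Let A be a commutative ℚ-algebra that is an integral domain, and let exp = Σ_{n≥0} Xⁿ/n! be the exponential power series in the formal power series ring A[[X]]. Then X and exp are algebraically independent over A; in particular exp is transcendental over the polynomial subring A[X] of A[[X]]: for every nonzero two-variable polynomial F over A, F(X, exp) ≠ 0 in A[[X]]. -/

import Mathlib

open PowerSeries

/-- The operator `p ↦ p' + k p` on polynomials. -/
noncomputable def expOp {A : Type*} [CommRing A] (k : ℕ) (p : Polynomial A) : Polynomial A :=
  Polynomial.derivative p + (k : Polynomial A) * p

theorem expOp_inj {A : Type*} [CommRing A] [IsDomain A] [Algebra ℚ A] (k : ℕ)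
    (p : Polynomial A) (h : expOp (k + 1) p = 0) : p = 0 := by
  have : CharZero A := algebraRat.charZero A
  by_contra hp
  have h1 := congrArg (fun q => Polynomial.coeff q p.natDegree) h
  have h2 : (Polynomial.derivative p).coeff p.natDegree = 0 := by
    rw [Polynomial.coeff_derivative, Polynomial.coeff_eq_zero_of_natDegree_lt (by omega), zero_mul]
  have h3 : (((k + 1 : ℕ) : Polynomial A) * p).coeff p.natDegree
      = ((k + 1 : ℕ) : A) * p.leadingCoeff := by
    rw [← Polynomial.C_eq_natCast, Polynomial.coeff_C_mul, Polynomial.leadingCoeff]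
  simp only [expOp, Polynomial.coeff_add, h2, h3, zero_add, Polynomial.coeff_zero] at h1
  rcases mul_eq_zero.mp h1 with h4 | h4
  · exact Nat.cast_ne_zero.mpr (Nat.succ_ne_zero k) h4
  · exact hp (Polynomial.leadingCoeff_eq_zero.mp h4)

theorem expOp_iterate_inj {A : Type*} [CommRing A] [IsDomain A] [Algebra ℚ A] (k m : ℕ)
    (p : Polynomial A) (h : (expOp (k + 1))^[m] p = 0) : p = 0 := by
  induction m with
  | zero => exact h
  | succ m ih =>
    rw [Function.iterate_succ_apply'] at h
    exact ih (expOp_inj _ _ h)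

theorem expOp_sum_zero {A : Type*} [CommRing A] [Algebra ℚ A] (n : ℕ)
    (p : ℕ → Polynomial A)
    (h : ∑ k ∈ Finset.range n, (p k : PowerSeries A) * exp A ^ k = 0) :
    ∑ k ∈ Finset.range n, (expOp k (p k) : PowerSeries A) * exp A ^ k = 0 := by
  have h1 := congrArg (derivative A) h
  rw [map_sum, map_zero] at h1
  rw [← h1]
  refine Finset.sum_congr rfl fun k _ => ?_
  rw [Derivation.leibniz, derivative_pow, derivative_exp, derivative_coe, expOp]
  have hc : ((k : Polynomial A) : PowerSeries A) = (k : PowerSeries A) := by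
    exact map_natCast (Polynomial.coeToPowerSeries.ringHom (R := A)) k
  rw [Polynomial.coe_add, Polynomial.coe_mul, hc]
  simp only [smul_eq_mul]
  rcases k with _ | k
  · simp
  · simp only [Nat.add_sub_cancel]
    ring

theorem exp_sum_indep {A : Type*} [CommRing A] [IsDomain A] [Algebra ℚ A] (n : ℕ) :
    ∀ (p : ℕ → Polynomial A),
    ∑ k ∈ Finset.range n, (p k : PowerSeries A) * exp A ^ k = 0 → ∀ k < n, p k = 0 := by
  induction n with
  | zero => intro p _ k hk; omega
  | succ n ih =>
    intro p h
    have hm : ∀ m : ℕ, ∑ k ∈ Finset.range (n + 1),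
        ((expOp k)^[m] (p k) : PowerSeries A) * exp A ^ k = 0 := by
      intro m
      induction m with
      | zero => simpa using h
      | succ m ihm =>
        simp only [Function.iterate_succ_apply']
        exact expOp_sum_zero (n + 1) (fun k => (expOp k)^[m] (p k)) ihm
    have h0 : (expOp 0)^[(p 0).natDegree + 1] (p 0) = 0 := by
      have : (expOp 0 : Polynomial A → Polynomial A) = Polynomial.derivative := by
        funext q; simp [expOp]
      rw [this]
      exact Polynomial.iterate_derivative_eq_zero (Nat.lt_succ_self _)
    have h1 := hm ((p 0).natDegree + 1)
    rw [Finset.sum_range_succ', h0] at h1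
    simp only [Polynomial.coe_zero, zero_mul, add_zero, pow_succ, ← mul_assoc] at h1
    rw [← Finset.sum_mul] at h1
    have h2 := (isUnit_exp A).mul_left_eq_zero.mp h1
    have h3 := ih (fun k => (expOp (k + 1))^[(p 0).natDegree + 1] (p (k + 1))) h2
    have h4 : ∀ k < n, p (k + 1) = 0 := fun k hk => expOp_iterate_inj k _ _ (h3 k hk)
    rw [Finset.sum_range_succ', Finset.sum_eq_zero, zero_add, pow_zero, mul_one] at h
    · intro k hk
      rcases k with _ | k
      · exact Polynomial.coe_eq_zero_iff.mp h
      · exact h4 k (by omega)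
    · intro k hk
      rw [h4 k (Finset.mem_range.mp hk), Polynomial.coe_zero, zero_mul]

theorem aeval_X_exp_ne_zero {A : Type*} [CommRing A] [IsDomain A] [Algebra ℚ A]
    (F : MvPolynomial (Fin 2) A)
    (hF : MvPolynomial.aeval ![(PowerSeries.X : PowerSeries A), PowerSeries.exp A] F = 0) :
    F = 0 := by
  have key : ∀ G : MvPolynomial (Fin 2) A,
      MvPolynomial.aeval ![(PowerSeries.X : PowerSeries A), PowerSeries.exp A] G =
      Polynomial.eval₂ (Polynomial.coeToPowerSeries.ringHom (R := A)) (exp A)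
        ((Polynomial.Bivariate.equivMvPolynomial A).symm G) := by
    intro G
    induction G using MvPolynomial.induction_on with
    | C a => simp [PowerSeries.algebraMap_apply]
    | add p q hp hq => rw [map_add, map_add, Polynomial.eval₂_add, hp, hq]
    | mul_X p i hp =>
      rw [map_mul, map_mul, Polynomial.eval₂_mul, hp]
      congr 1
      fin_cases i <;> simp
  rw [key, Polynomial.eval₂_eq_sum_range] at hF
  have h := exp_sum_indep _ (fun i => ((Polynomial.Bivariate.equivMvPolynomial A).symm F).coeff i) hF
  apply (Polynomial.Bivariate.equivMvPolynomial A).symm.injective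
  rw [map_zero]
  ext1 k
  by_cases hk : k < ((Polynomial.Bivariate.equivMvPolynomial A).symm F).natDegree + 1
  · rw [Polynomial.coeff_zero]; exact h k hk
  · rw [Polynomial.coeff_eq_zero_of_natDegree_lt (by omega), Polynomial.coeff_zero]


/-- Let `A` be a commutative `ℚ`-algebra which is an integral domain, and
let `exp = Σ Xⁿ/n!` be the exponential power series in `A⟦X⟧`. Then `X` and `exp` are
algebraically independent over `A`; in particular, for every nonzero two-variable
polynomial `F` over `A`, `F(X, exp) ≠ 0` in `A⟦X⟧`. -/
theorem X_and_exp_algebraically_independent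
    (A : Type*) [CommRing A] [IsDomain A] [Algebra ℚ A] :
    AlgebraicIndependent A ![(PowerSeries.X : PowerSeries A), PowerSeries.exp A] ∧
    ∀ F : MvPolynomial (Fin 2) A, F ≠ 0 →
      MvPolynomial.aeval ![(PowerSeries.X : PowerSeries A), PowerSeries.exp A] F ≠ 0 := by
  refine ⟨?_, fun F hF h => hF (aeval_X_exp_ne_zero F h)⟩
  rw [algebraicIndependent_iff]
  exact fun F h => aeval_X_exp_ne_zero F h
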